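/- Let α ∈ R with α ∉ B, let h be an integer with 1 ≤ h ≤ e, and suppose pʰ > 2. Let s be the smallest positive integer v such that αᵛ − 1 ∈ Bʰ or αᵛ + 1 ∈ Bʰ. Consider the set X of unordered pairs {x, −x} where x ranges over the elements of R/Bᵉ of additive order pʰ, with the map induced on X by multiplication by α (which is well defined and bijective, since α·(−x) = −(α·x) and α ∉ B). Then every orbit of this map on X has exactly s elements, and the number of orbits (i.e., the number of cycles of the induced functional graph) equals (Nʰ − N^{h−1})/(2s). -/

import Mathlib

set_option synthInstance.maxHeartbeats 1000000
set_option maxHeartbeats 1000000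

open NumberField

/-- The map induced by multiplication by `a` on subsets of a commutative ring. -/
def mulImage {R : Type*} [CommRing R] (a : R) : Set R → Set R :=
  fun S => (fun z => a * z) '' S

/-- If every nonempty fibre of `g` on a finite set `S` has `k` elements, then `S` has `k` times as
many elements as its image. -/
theorem ncard_eq_mul_ncard_image {X Y : Type*} {S : Set X} (hS : S.Finite) (g : X → Y) (k : ℕ)
    (hk : ∀ a ∈ S, {b ∈ S | g b = g a}.ncard = k) : S.ncard = k * (g '' S).ncard := by
  classical
  lift S to Finset X using hS
  rw [← Finset.coe_image, Set.ncard_coe_finset, Set.ncard_coe_finset,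
    Finset.card_eq_sum_card_image g S, mul_comm]
  refine Finset.sum_const_nat fun b hb => ?_
  obtain ⟨a, ha, rfl⟩ := Finset.mem_image.1 hb
  rw [← hk a ha, ← Set.ncard_coe_finset]
  congr 1
  ext
  simp

/-- The forward orbit of a point under a self-map. -/
def forwardOrbit {X : Type*} (f : X → X) (x : X) : Set X := {y | ∃ n : ℕ, f^[n] x = y}

theorem ncard_forwardOrbit {X : Type*} {f : X → X} {x : X}
    (hx : 0 < Function.minimalPeriod f x) :
    (forwardOrbit f x).ncard = Function.minimalPeriod f x := by
  have himage : forwardOrbit f x = (f^[·] x) '' Set.Iio (Function.minimalPeriod f x) := by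
    ext y
    constructor
    · rintro ⟨n, rfl⟩
      exact ⟨n % Function.minimalPeriod f x, Nat.mod_lt _ hx,
        Function.iterate_mod_minimalPeriod_eq⟩
    · rintro ⟨n, -, rfl⟩
      exact ⟨n, rfl⟩
  rw [himage, Function.iterate_injOn_Iio_minimalPeriod.ncard_image,
    ← Finset.coe_Iio, Set.ncard_coe_finset, Nat.card_Iio]

theorem forwardOrbit_eq_iff_mem {X : Type*} {f : X → X} {x y : X}
    (hx : 0 < Function.minimalPeriod f x) :
    forwardOrbit f y = forwardOrbit f x ↔ y ∈ forwardOrbit f x := by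
  constructor
  · intro hxy
    exact hxy ▸ ⟨0, rfl⟩
  · rintro ⟨n, rfl⟩
    ext z
    constructor
    · rintro ⟨m, rfl⟩
      exact ⟨m + n, Function.iterate_add_apply f m n x⟩
    · rintro ⟨m, rfl⟩
      have hper : f^[n * Function.minimalPeriod f x] x = x :=
        (Function.isPeriodicPt_minimalPeriod f x).const_mul n
      obtain ⟨d, hd⟩ := Nat.exists_eq_add_of_le (Nat.le_mul_of_pos_right n hx)
      refine ⟨m + d, ?_⟩
      rw [← Function.iterate_add_apply, add_assoc, add_comm d n, ← hd,
        Function.iterate_add_apply, hper]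

/-- A finite set stable under `f`, all of whose points have minimal period `s`, splits into
orbits of `s` elements. -/
theorem ncard_eq_mul_ncard_image_forwardOrbit {X : Type*} {f : X → X} {S : Set X}
    (hS : S.Finite) (hf : Set.MapsTo f S S) {s : ℕ} (hs : 0 < s)
    (hper : ∀ x ∈ S, Function.minimalPeriod f x = s) :
    S.ncard = s * (forwardOrbit f '' S).ncard := by
  refine ncard_eq_mul_ncard_image hS _ s fun x hx => ?_
  have hpos : 0 < Function.minimalPeriod f x := (hper x hx).symm ▸ hs
  rw [← hper x hx, ← ncard_forwardOrbit hpos]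
  congr 1
  ext y
  simp only [Set.mem_ofPred_eq, forwardOrbit_eq_iff_mem hpos, and_iff_right_iff_imp]
  rintro ⟨n, rfl⟩
  exact hf.iterate n hx

theorem pair_neg_eq_pair_neg_iff {A : Type*} [AddGroup A] {x y : A} :
    ({y, -y} : Set A) = {x, -x} ↔ y = x ∨ y = -x := by
  constructor
  · intro hxy
    have hy : y ∈ ({x, -x} : Set A) := hxy ▸ Set.mem_insert y {-y}
    simpa using hy
  · rintro (rfl | rfl)
    · rfl
    · rw [neg_neg, Set.pair_comm]

theorem ncard_eq_two_mul_ncard_image_pair_neg {A : Type*} [AddGroup A] {S : Set A}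
    (hS : S.Finite) (hneg : ∀ x ∈ S, -x ∈ S) (hne : ∀ x ∈ S, x ≠ -x) :
    S.ncard = 2 * ((fun x => ({x, -x} : Set A)) '' S).ncard := by
  refine ncard_eq_mul_ncard_image hS _ 2 fun x hx => ?_
  rw [← Set.ncard_pair (hne x hx)]
  congr 1
  ext y
  simp only [Set.mem_ofPred_eq, pair_neg_eq_pair_neg_iff, Set.mem_insert_iff,
    Set.mem_singleton_iff, and_iff_right_iff_imp]
  rintro (rfl | rfl)
  exacts [hx, hneg _ hx]

theorem mulImage_pair_neg {A : Type*} [CommRing A] (a x : A) :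
    mulImage a {x, -x} = {a * x, -(a * x)} := by
  simp [mulImage, Set.image_pair]

theorem mulImage_iterate_pair_neg {A : Type*} [CommRing A] (a x : A) (n : ℕ) :
    (mulImage a)^[n] {x, -x} = {a ^ n * x, -(a ^ n * x)} := by
  induction n with
  | zero => simp
  | succ n ih => rw [Function.iterate_succ_apply', ih, mulImage_pair_neg, pow_succ', mul_assoc]

theorem mem_pow_of_mul_mem_pow_add {R : Type*} [CommRing R] [IsDedekindDomain R] {B : Ideal R}
    (hB : Prime B) {a b : R} {i j : ℕ} (ha : a ∉ B ^ (i + 1)) (hab : a * b ∈ B ^ (i + j)) :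
    b ∈ B ^ j := by
  rw [← Ideal.span_singleton_le_iff_mem, ← Ideal.dvd_iff_le, pow_dvd_iff_le_emultiplicity]
    at ha hab ⊢
  rw [← Ideal.span_singleton_mul_span_singleton, emultiplicity_mul hB] at hab
  have hi : emultiplicity B (Ideal.span {a}) ≤ i := by
    rw [not_le, Nat.cast_add, Nat.cast_one] at ha
    exact Order.le_of_lt_add_one ha
  have hij : (i : ℕ∞) + j ≤ i + emultiplicity B (Ideal.span {b}) := by
    rw [← Nat.cast_add]
    exact hab.trans (by gcongr)
  exact (ENat.add_le_add_iff_left (ENat.natCast_ne_top i)).1 hij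

theorem pow_notMem_pow_succ {R : Type*} [CommRing R] [IsDedekindDomain R] {B : Ideal R}
    (hB : Prime B) {a : R} (ha : a ∉ B ^ 2) (k : ℕ) : a ^ k ∉ B ^ (k + 1) := by
  induction k with
  | zero =>
    rw [pow_zero, zero_add, pow_one]
    exact fun h1 => hB.not_isUnit (Ideal.isUnit_iff.2 ((Ideal.eq_top_iff_one B).2 h1))
  | succ k ih =>
    intro hk
    rw [pow_succ' a, add_comm (k + 1) 1] at hk
    exact ih (mem_pow_of_mul_mem_pow_add hB ha hk)

theorem pow_mul_mem_pow_iff {R : Type*} [CommRing R] [IsDedekindDomain R] {B : Ideal R}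
    (hB : Prime B) {a : R} (ha : a ∈ B) (ha2 : a ∉ B ^ 2) {k e : ℕ} (hke : k ≤ e) {r : R} :
    a ^ k * r ∈ B ^ e ↔ r ∈ B ^ (e - k) := by
  obtain ⟨j, rfl⟩ := Nat.exists_eq_add_of_le hke
  rw [Nat.add_sub_cancel_left]
  refine ⟨mem_pow_of_mul_mem_pow_add hB (pow_notMem_pow_succ hB ha2 k), fun hr => ?_⟩
  rw [pow_add]
  exact Ideal.mul_mem_mul (Ideal.pow_mem_pow ha k) hr

/-- In `R/Bᵉ`, the image of `B^(e-k)` has `N(B)ᵏ` elements. -/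
theorem ncard_image_mk_pow_sub {R : Type*} [CommRing R] [IsDedekindDomain R] [Module.Free ℤ R]
    [Module.Finite ℤ R] {B : Ideal R} (hB0 : B ≠ ⊥) {k e : ℕ} (hke : k ≤ e) :
    (Ideal.Quotient.mk (B ^ e) '' (B ^ (e - k) : Ideal R)).ncard = Ideal.absNorm B ^ k := by
  have hindex (n : ℕ) :
      (Submodule.toAddSubgroup (B ^ n)).index = Ideal.absNorm B ^ n := by
    rw [← map_pow]
    rfl
  have hker : (Ideal.Quotient.mk (B ^ e)).toAddMonoidHom.ker =
      Submodule.toAddSubgroup (B ^ e) := by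
    ext r
    exact Ideal.Quotient.eq_zero_iff_mem
  have hcard := AddSubgroup.relIndex_ker (K := Submodule.toAddSubgroup (B ^ (e - k)))
    (Ideal.Quotient.mk (B ^ e)).toAddMonoidHom
  have hle : Submodule.toAddSubgroup (B ^ e) ≤ Submodule.toAddSubgroup (B ^ (e - k)) :=
    Ideal.pow_le_pow_right (Nat.sub_le e k)
  have hmul := AddSubgroup.relIndex_mul_index hle
  rw [← hker, hcard, hker, hindex, hindex] at hmul
  have hpos : 0 < Ideal.absNorm B := Nat.pos_of_ne_zero (Ideal.absNorm_eq_zero_iff.not.2 hB0)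
  refine Nat.eq_of_mul_eq_mul_right (pow_pos hpos (e - k)) (Eq.trans ?_ (hmul.trans ?_))
  · rfl
  · rw [← pow_add, Nat.add_sub_cancel' hke]

theorem addOrderOf_eq_prime_pow_iff {A : Type*} [AddMonoid A] {p h : ℕ} (hp : p.Prime)
    (hh : 1 ≤ h) {x : A} :
    addOrderOf x = p ^ h ↔ p ^ h • x = 0 ∧ p ^ (h - 1) • x ≠ 0 := by
  have : Fact p.Prime := ⟨hp⟩
  obtain ⟨k, rfl⟩ := Nat.exists_eq_add_of_le' hh
  rw [Nat.add_sub_cancel]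
  constructor
  · intro hx
    refine ⟨hx ▸ addOrderOf_nsmul_eq_zero x, fun hk => ?_⟩
    have hdvd := addOrderOf_dvd_of_nsmul_eq_zero hk
    rw [hx, Nat.pow_dvd_pow_iff_le_right hp.one_lt] at hdvd
    omega
  · rintro ⟨h1, h2⟩
    exact addOrderOf_eq_prime_pow h2 h1

section PrimePowerQuotient

variable {R : Type*} [CommRing R] [IsDedekindDomain R] {B : Ideal R} {p : ℕ}

theorem nsmul_mk_eq_zero_iff (hB : Prime B) (hpB : (p : R) ∈ B) (hpB2 : (p : R) ∉ B ^ 2)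
    {k e : ℕ} (hke : k ≤ e) {r : R} :
    p ^ k • Ideal.Quotient.mk (B ^ e) r = 0 ↔ r ∈ B ^ (e - k) := by
  rw [← pow_mul_mem_pow_iff hB hpB hpB2 hke, ← Ideal.Quotient.eq_zero_iff_mem, map_mul, map_pow,
    map_natCast, nsmul_eq_mul, Nat.cast_pow]

theorem setOf_nsmul_eq_zero (hB : Prime B) (hpB : (p : R) ∈ B) (hpB2 : (p : R) ∉ B ^ 2)
    {k e : ℕ} (hke : k ≤ e) :
    {x : R ⧸ B ^ e | p ^ k • x = 0} =
      Ideal.Quotient.mk (B ^ e) '' (B ^ (e - k) : Ideal R) := by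
  ext x
  constructor
  · intro hx
    obtain ⟨r, rfl⟩ := Ideal.Quotient.mk_surjective x
    exact ⟨r, (nsmul_mk_eq_zero_iff hB hpB hpB2 hke).1 hx, rfl⟩
  · rintro ⟨r, hr, rfl⟩
    exact (nsmul_mk_eq_zero_iff hB hpB hpB2 hke).2 hr

/-- The number of elements of additive order `pʰ` in `R/Bᵉ`. -/
theorem ncard_addOrderOf_eq_prime_pow [Module.Free ℤ R] [Module.Finite ℤ R]
    (hB : Prime B) (hp : p.Prime) (hpB : (p : R) ∈ B) (hpB2 : (p : R) ∉ B ^ 2)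
    {h e : ℕ} (hh : 1 ≤ h) (hhe : h ≤ e) :
    {x : R ⧸ B ^ e | addOrderOf x = p ^ h}.ncard =
      Ideal.absNorm B ^ h - Ideal.absNorm B ^ (h - 1) := by
  have hfin : Finite (R ⧸ B ^ e) :=
    Ideal.finiteQuotientOfFreeOfNeBot _ (pow_ne_zero e hB.ne_zero)
  have hdiff : {x : R ⧸ B ^ e | addOrderOf x = p ^ h} =
      {x : R ⧸ B ^ e | p ^ h • x = 0} \ {x : R ⧸ B ^ e | p ^ (h - 1) • x = 0} := by
    ext x
    exact addOrderOf_eq_prime_pow_iff hp hh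
  have hsub : {x : R ⧸ B ^ e | p ^ (h - 1) • x = 0} ⊆ {x : R ⧸ B ^ e | p ^ h • x = 0} := by
    intro x (hx : p ^ (h - 1) • x = 0)
    obtain ⟨k, rfl⟩ := Nat.exists_eq_add_of_le' hh
    rw [Nat.add_sub_cancel] at hx
    rw [Set.mem_ofPred_eq, pow_succ', mul_nsmul', hx, nsmul_zero]
  rw [hdiff, Set.ncard_sdiff hsub (Set.toFinite _), setOf_nsmul_eq_zero hB hpB hpB2 hhe,
    setOf_nsmul_eq_zero hB hpB hpB2 ((Nat.sub_le h 1).trans hhe),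
    ncard_image_mk_pow_sub hB.ne_zero hhe,
    ncard_image_mk_pow_sub hB.ne_zero ((Nat.sub_le h 1).trans hhe)]

/-- The annihilator of an element of additive order `pʰ` in `R/Bᵉ` is `Bʰ`. -/
theorem mk_mul_eq_zero_iff_of_addOrderOf (hB : Prime B) (hp : p.Prime) (hpB : (p : R) ∈ B)
    (hpB2 : (p : R) ∉ B ^ 2) {h e : ℕ} (hh : 1 ≤ h) (hhe : h ≤ e) {x : R ⧸ B ^ e}
    (hx : addOrderOf x = p ^ h) (b : R) :
    Ideal.Quotient.mk (B ^ e) b * x = 0 ↔ b ∈ B ^ h := by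
  obtain ⟨r, rfl⟩ := Ideal.Quotient.mk_surjective x
  rw [addOrderOf_eq_prime_pow_iff hp hh, Ne, nsmul_mk_eq_zero_iff hB hpB hpB2 hhe,
    nsmul_mk_eq_zero_iff hB hpB hpB2 ((Nat.sub_le h 1).trans hhe)] at hx
  obtain ⟨hr, hr'⟩ := hx
  rw [← map_mul, Ideal.Quotient.eq_zero_iff_mem]
  constructor
  · intro hbr
    rw [show e - (h - 1) = e - h + 1 by omega] at hr'
    refine mem_pow_of_mul_mem_pow_add hB hr' ?_
    rwa [mul_comm, Nat.sub_add_cancel hhe]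
  · intro hb
    rw [← Nat.add_sub_cancel' hhe, pow_add]
    exact Ideal.mul_mem_mul hb hr

theorem isPeriodicPt_mulImage_pair_neg_iff (hB : Prime B) (hp : p.Prime) (hpB : (p : R) ∈ B)
    (hpB2 : (p : R) ∉ B ^ 2) {h e : ℕ} (hh : 1 ≤ h) (hhe : h ≤ e) {x : R ⧸ B ^ e}
    (hx : addOrderOf x = p ^ h) (a : R) (n : ℕ) :
    Function.IsPeriodicPt (mulImage (Ideal.Quotient.mk (B ^ e) a)) n {x, -x} ↔
      a ^ n - 1 ∈ B ^ h ∨ a ^ n + 1 ∈ B ^ h := by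
  rw [Function.IsPeriodicPt, Function.IsFixedPt, mulImage_iterate_pair_neg,
    pair_neg_eq_pair_neg_iff,
    ← mk_mul_eq_zero_iff_of_addOrderOf hB hp hpB hpB2 hh hhe hx,
    ← mk_mul_eq_zero_iff_of_addOrderOf hB hp hpB hpB2 hh hhe hx,
    map_sub, map_add, map_pow, map_one, sub_mul, add_mul, one_mul, sub_eq_zero,
    add_eq_zero_iff_eq_neg]

end PrimePowerQuotient

theorem minimalPeriod_eq_sInf {X : Type*} {f : X → X} {x : X}
    (hx : x ∈ Function.periodicPts f) :
    Function.minimalPeriod f x = sInf {n : ℕ | 0 < n ∧ Function.IsPeriodicPt f n x} := by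
  apply le_antisymm
  · obtain ⟨hpos, hper⟩ := Nat.sInf_mem (s := {n : ℕ | 0 < n ∧ Function.IsPeriodicPt f n x}) hx
    exact hper.minimalPeriod_le hpos
  · exact Nat.sInf_le ⟨Function.minimalPeriod_pos_of_mem_periodicPts hx,
      Function.isPeriodicPt_minimalPeriod f x⟩

theorem exists_pow_sub_one_mem_pow {R : Type*} [CommRing R] {B : Ideal R} [B.IsMaximal] {h : ℕ}
    [Finite (R ⧸ B ^ h)] {a : R} (ha : a ∉ B) : ∃ v : ℕ, 0 < v ∧ a ^ v - 1 ∈ B ^ h := by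
  obtain ⟨u, hu⟩ := Ideal.Quotient.isUnit_mk_pow_of_notMem B (n := h) ha
  refine ⟨orderOf u, orderOf_pos u, ?_⟩
  rw [← Ideal.Quotient.eq_zero_iff_mem, map_sub, map_pow, map_one, ← hu, ← Units.val_pow_eq_pow_val,
    pow_orderOf_eq_one, Units.val_one, sub_self]

theorem addOrderOf_mul_of_isUnit {A : Type*} [CommRing A] {a : A} (ha : IsUnit a) (x : A) :
    addOrderOf (a * x) = addOrderOf x :=
  addOrderOf_injective (AddMonoidHom.mulLeft a) ha.mul_right_injective x

/-- Let `α ∉ B`, `1 ≤ h ≤ e`, `pʰ > 2`, and let `s` be the least positive `v` with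
`αᵛ - 1 ∈ Bʰ` or `αᵛ + 1 ∈ Bʰ`. Multiplication by `α` induces a map on the set of unordered
pairs `{x, -x}` of elements of `R/Bᵉ` of additive order `pʰ`; every orbit of this map has
exactly `s` elements, and the number of orbits is `(N(B)ʰ - N(B)^(h-1))/(2s)`. -/
theorem stmt11 (K : Type*) [Field K] [NumberField K]
    (hK : Module.finrank ℚ K = 2)
    (B : Ideal (RingOfIntegers K)) (hBprime : B.IsPrime) (hB0 : B ≠ ⊥)
    (p : ℕ) (hp : p.Prime)
    (hpB : (p : RingOfIntegers K) ∈ B) (hpB2 : (p : RingOfIntegers K) ∉ B ^ 2)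
    (e : ℕ) (he : 0 < e)
    (α : RingOfIntegers K) (hα : α ∉ B)
    (h : ℕ) (hh1 : 1 ≤ h) (hhe : h ≤ e) (hph : 2 < p ^ h)
    (s : ℕ) (hs : s = sInf {v : ℕ | 0 < v ∧ (α ^ v - 1 ∈ B ^ h ∨ α ^ v + 1 ∈ B ^ h)}) :
    (∀ P : Set (RingOfIntegers K ⧸ B ^ e),
      (∃ x : RingOfIntegers K ⧸ B ^ e, addOrderOf x = p ^ h ∧ P = {x, -x}) →
      Nat.card {S : Set (RingOfIntegers K ⧸ B ^ e) |
        ∃ n : ℕ, (mulImage (Ideal.Quotient.mk (B ^ e) α))^[n] P = S} = s) ∧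
    Nat.card {O : Set (Set (RingOfIntegers K ⧸ B ^ e)) |
        ∃ P : Set (RingOfIntegers K ⧸ B ^ e),
          (∃ x : RingOfIntegers K ⧸ B ^ e, addOrderOf x = p ^ h ∧ P = {x, -x}) ∧
          O = {S | ∃ n : ℕ, (mulImage (Ideal.Quotient.mk (B ^ e) α))^[n] P = S}} =
      (Ideal.absNorm B ^ h - Ideal.absNorm B ^ (h - 1)) / (2 * s) := by
  have hB : Prime B := Ideal.prime_of_isPrime hB0 hBprime
  have hmax : B.IsMaximal := hBprime.isMaximal hB0
  have hfin (n : ℕ) : Finite (RingOfIntegers K ⧸ B ^ n) :=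
    Ideal.finiteQuotientOfFreeOfNeBot _ (pow_ne_zero n hB0)
  set f := mulImage (Ideal.Quotient.mk (B ^ e) α)
  set T : Set (RingOfIntegers K ⧸ B ^ e) := {x | addOrderOf x = p ^ h} with hT
  set X : Set (Set (RingOfIntegers K ⧸ B ^ e)) := (fun x => {x, -x}) '' T with hX
  obtain ⟨v, hv, hαv⟩ := exists_pow_sub_one_mem_pow (h := h) hα
  have hs0 : 0 < s := hs ▸ (Nat.sInf_mem
    (s := {v : ℕ | 0 < v ∧ (α ^ v - 1 ∈ B ^ h ∨ α ^ v + 1 ∈ B ^ h)}) ⟨v, hv, Or.inl hαv⟩).1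
  have hper : ∀ P ∈ X, Function.minimalPeriod f P = s := by
    rintro _ ⟨x, hx, rfl⟩
    have hiff := isPeriodicPt_mulImage_pair_neg_iff hB hp hpB hpB2 hh1 hhe hx α
    rw [minimalPeriod_eq_sInf ⟨v, hv, (hiff v).2 (Or.inl hαv)⟩, hs]
    simp only [hiff]
  have hmaps : Set.MapsTo f X X := by
    rintro _ ⟨x, hx, rfl⟩
    refine ⟨Ideal.Quotient.mk (B ^ e) α * x, ?_, (mulImage_pair_neg _ x).symm⟩
    exact (addOrderOf_mul_of_isUnit (Ideal.Quotient.isUnit_mk_pow_of_notMem B hα) x).trans hx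
  have hTX : T.ncard = 2 * X.ncard := by
    refine ncard_eq_two_mul_ncard_image_pair_neg (Set.toFinite T)
      (fun x hx => (addOrderOf_neg x).trans hx) fun x hx hneg => ?_
    have hdvd : addOrderOf x ∣ 2 := addOrderOf_dvd_of_nsmul_eq_zero <| by
      rw [two_nsmul, ← eq_neg_iff_add_eq_zero]
      exact hneg
    exact absurd (Nat.le_of_dvd two_pos (hx ▸ hdvd)) (not_le.2 hph)
  have hcount : {O : Set (Set (RingOfIntegers K ⧸ B ^ e)) |
      ∃ P : Set (RingOfIntegers K ⧸ B ^ e),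
        (∃ x : RingOfIntegers K ⧸ B ^ e, addOrderOf x = p ^ h ∧ P = {x, -x}) ∧
        O = {S | ∃ n : ℕ, f^[n] P = S}} = forwardOrbit f '' X := by
    ext O
    simp only [hX, hT, Set.mem_image, Set.mem_ofPred_eq, forwardOrbit, eq_comm]
  refine ⟨?_, ?_⟩
  · rintro P ⟨x, hx, rfl⟩
    have hP := hper _ ⟨x, hx, rfl⟩
    exact (ncard_forwardOrbit (hP.symm ▸ hs0)).trans hP
  · rw [hcount, Nat.card_coe_set_eq, ← ncard_addOrderOf_eq_prime_pow hB hp hpB hpB2 hh1 hhe, ← hT,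
      hTX, ncard_eq_mul_ncard_image_forwardOrbit (Set.toFinite X) hmaps hs0 hper, ← mul_assoc,
      Nat.mul_div_cancel_left _ (Nat.mul_pos two_pos hs0)]
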